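/- Integral representation of the coefficient from final-time data (d dimensions): let a : ℝ → ℝ be continuously differentiable, let u̲ < u̅, and let φ : [u̲,u̅] → Ω ⊆ EuclideanSpace ℝ (Fin d) and g : Ω → ℝ be such that g(φ(τ)) = τ for all τ ∈ [u̲,u̅], the functions τ ↦ Δg(φ(τ)) and τ ↦ ‖∇g(φ(τ))‖² are continuous, and ‖∇g(φ(τ))‖ ≥ κ > 0 for all τ. Suppose f : [u̲,u̅] → ℝ is continuous and a'(τ) ‖∇g(φ(τ))‖² + a(τ) Δg(φ(τ)) = f(τ) for all τ ∈ [u̲,u̅]. Then with a⁰ := a(u̲), for every τ ∈ [u̲,u̅]: a(τ) = exp( −∫_{u̲}^{τ} Δg(φ(ρ)) / ‖∇g(φ(ρ))‖² dρ ) · a⁰ + ∫_{u̲}^{τ} [ f(σ) / ‖∇g(φ(σ))‖² ] · exp( −∫_{σ}^{τ} Δg(φ(ρ)) / ‖∇g(φ(ρ))‖² dρ ) dσ. -/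

import Mathlib

open Set

/-- Partial derivative of a scalar field on `EuclideanSpace ℝ (Fin d)` in the
`i`-th standard coordinate direction. -/
noncomputable def pd {d : ℕ} (i : Fin d) (v : EuclideanSpace ℝ (Fin d) → ℝ) :
    EuclideanSpace ℝ (Fin d) → ℝ :=
  fun x => fderiv ℝ v x (EuclideanSpace.single i 1)

/-- Laplacian of a scalar field: sum of the pure second partial derivatives. -/
noncomputable def lap {d : ℕ} (v : EuclideanSpace ℝ (Fin d) → ℝ) :
    EuclideanSpace ℝ (Fin d) → ℝ :=
  fun x => ∑ i, pd i (pd i v) x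

theorem voc_aux (a q F : ℝ → ℝ) (ha : ContDiff ℝ 1 a) (lo hi : ℝ) (hu : lo ≤ hi)
    (hq : ContinuousOn q (Icc lo hi))
    (hode : ∀ t ∈ Icc lo hi, deriv a t + a t * q t = F t) :
    ∀ t ∈ Icc lo hi, a t = Real.exp (-(∫ r in lo..t, q r)) * a lo
      + ∫ s in lo..t, F s * Real.exp (-(∫ r in s..t, q r)) := by
  intro t ht
  set Q : ℝ → ℝ := IccExtend hu ((Icc lo hi).domRestrict q) with hQ
  have hQc : Continuous Q := hq.domRestrict.Icc_extend'
  have hQq : ∀ s ∈ Icc lo hi, Q s = q s := fun s hs => by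
    rw [hQ, IccExtend_of_mem hu _ hs]; rfl
  have hint : ∀ s ∈ Icc lo t, (∫ r in s..t, q r) = ∫ r in s..t, Q r := by
    intro s hs
    apply intervalIntegral.integral_congr
    intro r hr
    rw [uIcc_of_le hs.2] at hr
    exact (hQq r ⟨hs.1.trans hr.1, hr.2.trans ht.2⟩).symm
  have hd : ∀ s, HasDerivAt (fun s => ∫ r in t..s, Q r) (Q s) s := fun s =>
    intervalIntegral.integral_hasDerivAt_right (hQc.intervalIntegrable _ _)
      (hQc.stronglyMeasurableAtFilter _ _) hQc.continuousAt
  have hH : ∀ s, HasDerivAt (fun s => a s * Real.exp (∫ r in t..s, Q r))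
      (deriv a s * Real.exp (∫ r in t..s, Q r)
        + a s * (Real.exp (∫ r in t..s, Q r) * Q s)) s := fun s =>
    ((ha.differentiable (by norm_num)) s).hasDerivAt.mul (hd s).exp
  have hIc : Continuous (fun s => ∫ r in t..s, Q r) :=
    continuous_iff_continuousAt.2 fun s => (hd s).continuousAt
  have hac : Continuous (deriv a) := ha.continuous_deriv le_rfl
  have hacc : Continuous a := ha.continuous
  have key := intervalIntegral.integral_eq_sub_of_hasDerivAt (a := lo) (b := t)
    (fun s _ => hH s) (Continuous.intervalIntegrable (by fun_prop) _ _)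
  have hc : (∫ s in lo..t, F s * Real.exp (-(∫ r in s..t, q r))) =
      ∫ s in lo..t, (deriv a s * Real.exp (∫ r in t..s, Q r)
        + a s * (Real.exp (∫ r in t..s, Q r) * Q s)) := by
    apply intervalIntegral.integral_congr
    intro s hs
    rw [uIcc_of_le ht.1] at hs
    have hs' : s ∈ Icc lo hi := ⟨hs.1, hs.2.trans ht.2⟩
    simp only
    rw [hint s hs, ← intervalIntegral.integral_symm, ← hode s hs', ← hQq s hs']
    ring
  rw [hc, key, hint lo ⟨le_rfl, ht.1⟩, ← intervalIntegral.integral_symm]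
  simp
  ring

/-- Integral representation of the coefficient from final-time data in `d`
dimensions: if `a'(τ)‖∇g(φ(τ))‖² + a(τ)Δg(φ(τ)) = f(τ)` on `[u̲,u̅]`, where
`φ` inverts the data `g` along the observation curve and `‖∇g(φ(·))‖ ≥ κ > 0`,
then `a` is given by the variation-of-constants formula with `a⁰ = a(u̲)`. -/
theorem stmt_10 {d : ℕ}
    (a : ℝ → ℝ) (ha : ContDiff ℝ 1 a)
    (ulo uhi : ℝ) (hu : ulo < uhi)
    (Ω : Set (EuclideanSpace ℝ (Fin d)))
    (φ : ℝ → EuclideanSpace ℝ (Fin d))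
    (hφΩ : ∀ τ ∈ Icc ulo uhi, φ τ ∈ Ω)
    (g : EuclideanSpace ℝ (Fin d) → ℝ)
    (hinv : ∀ τ ∈ Icc ulo uhi, g (φ τ) = τ)
    (hlapc : ContinuousOn (fun τ => lap g (φ τ)) (Icc ulo uhi))
    (hgradc : ContinuousOn (fun τ => ‖gradient g (φ τ)‖ ^ 2) (Icc ulo uhi))
    (κ : ℝ) (hκ : 0 < κ)
    (hgradlow : ∀ τ ∈ Icc ulo uhi, κ ≤ ‖gradient g (φ τ)‖)
    (f : ℝ → ℝ) (hf : ContinuousOn f (Icc ulo uhi))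
    (hode : ∀ τ ∈ Icc ulo uhi,
      deriv a τ * ‖gradient g (φ τ)‖ ^ 2 + a τ * lap g (φ τ) = f τ)
    (a0 : ℝ) (ha0 : a0 = a ulo) :
    ∀ τ ∈ Icc ulo uhi,
      a τ = Real.exp (-(∫ ρ in ulo..τ, lap g (φ ρ) / ‖gradient g (φ ρ)‖ ^ 2)) * a0
        + ∫ σ in ulo..τ, (f σ / ‖gradient g (φ σ)‖ ^ 2)
            * Real.exp (-(∫ ρ in σ..τ, lap g (φ ρ) / ‖gradient g (φ ρ)‖ ^ 2)) := by
  have hpos : ∀ t ∈ Icc ulo uhi, ‖gradient g (φ t)‖ ^ 2 ≠ 0 := fun t ht =>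
    pow_ne_zero 2 (hκ.trans_le (hgradlow t ht)).ne'
  subst ha0
  refine voc_aux a (fun r => lap g (φ r) / ‖gradient g (φ r)‖ ^ 2)
    (fun s => f s / ‖gradient g (φ s)‖ ^ 2) ha ulo uhi hu.le (hlapc.div hgradc hpos) ?_
  intro t ht
  have h := hpos t ht
  rw [← hode t ht, add_div, mul_div_cancel_right₀ _ h, mul_div_assoc]
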